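/- arXiv:2011.00039 — 3 statements merged into one kernel-verified Lean document; each statement's English description precedes it below -/
import Mathlib

section
/- Let ν ∈ (0,1/2], a ∈ (0, 1/2 − ν], c(a) = 1/2 − a, and λ_{ν,a} = √(c(a)² − ν²)/c(a). Then for every χ ∈ C_c^∞(ℝ²∖{0},ℂ), ∫_{ℝ²} ( |D_a χ(x)|² / (1 + λ_{ν,a} + ν/|x|) + (1 − λ_{ν,a} − ν/|x|) |χ(x)|² ) dx ≥ 0. -/
open MeasureTheory

/-- The Wirtinger derivative `∂_z η = (1/2)(∂₁ η - i ∂₂ η)`, identifying `ℝ²` with `ℂ`. -/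
noncomputable def wirtingerZ (η : ℂ → ℂ) (x : ℂ) : ℂ :=
  (1/2 : ℂ) * (fderiv ℝ η x 1 - Complex.I * fderiv ℝ η x Complex.I)

/-- The Wirtinger derivative `∂_{z̄} η = (1/2)(∂₁ η + i ∂₂ η)`, identifying `ℝ²` with `ℂ`. -/
noncomputable def wirtingerZbar (η : ℂ → ℂ) (x : ℂ) : ℂ :=
  (1/2 : ℂ) * (fderiv ℝ η x 1 + Complex.I * fderiv ℝ η x Complex.I)

/-- The magnetic operator `D_a χ = -2i ∂_z χ + i a (z̄/|z|²) χ`. -/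
noncomputable def Dop (a : ℝ) (χ : ℂ → ℂ) (x : ℂ) : ℂ :=
  (-2) * Complex.I * wirtingerZ χ x
    + Complex.I * (a : ℂ) * ((starRingEnd ℂ) x / ((‖x‖ : ℂ)^2)) * χ x

/-- The magnetic operator `D_a^* φ = -2i ∂_{z̄} φ - i a (z/|z|²) φ`. -/
noncomputable def DopStar (a : ℝ) (φ : ℂ → ℂ) (x : ℂ) : ℂ :=
  (-2) * Complex.I * wirtingerZbar φ x
    - Complex.I * (a : ℂ) * (x / ((‖x‖ : ℂ)^2)) * φ x


/-- Completing the square in the first-order term, against the multiplier `b`. -/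
lemma two_mul_inner_sub_le_normSq_div {W : ℝ} (hW : 0 < W) (b : ℝ) (A z : ℂ) :
    2 * b * inner ℝ z A - W * b ^ 2 * ‖z‖ ^ 2 ≤ ‖A‖ ^ 2 / W := by
  rw [le_div_iff₀ hW]
  have h : 0 ≤ ‖A - (b * W) • z‖ ^ 2 := by positivity
  rw [norm_sub_sq_real, norm_smul, real_inner_smul_right, real_inner_comm, mul_pow,
    Real.norm_eq_abs, sq_abs] at h
  nlinarith [h]

/-- The radial Dirac–Coulomb Hardy inequality in a single angular channel. -/
lemma radial_hardy {ν c L b κ ε R : ℝ} (hν : 0 < ν) (hL : 0 ≤ L)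
    (hb : b ^ 2 * (1 + L) = 1 - L) (hcb : ν * (1 + b ^ 2) = 2 * c * b) (hb0 : 0 ≤ b)
    (hκ : c ≤ |κ - 1 / 2|) (hε : 0 < ε) (hR : ε ≤ R) {f f' : ℝ → ℂ}
    (hf : ∀ r, HasDerivAt f (f' r) r) (hf' : Continuous f') (h0 : f ε = 0) (h1 : f R = 0) :
    0 ≤ ∫ r in ε..R, r * (‖f' r + ((κ / r : ℝ) : ℂ) * f r‖ ^ 2 / (1 + L + ν / r)
      + (1 - L - ν / r) * ‖f r‖ ^ 2) := by
  have hfc : Continuous f := continuous_iff_continuousAt.2 fun r => (hf r).continuousAt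
  obtain ⟨B, hB2, hBκ⟩ : ∃ B : ℝ, B ^ 2 = b ^ 2 ∧ B * (κ - 1 / 2) = b * |κ - 1 / 2| := by
    rcases abs_cases (κ - 1 / 2) with ⟨h, _⟩ | ⟨h, _⟩
    · exact ⟨b, rfl, by rw [h]⟩
    · exact ⟨-b, by ring, by rw [h]; ring⟩
  have hder : ∀ r, HasDerivAt (fun r => B * r * ‖f r‖ ^ 2)
      (B * ‖f r‖ ^ 2 + B * r * (2 * inner ℝ (f r) (f' r))) r := fun r => by
    convert! ((hasDerivAt_id r).const_mul B).mul (hf r).norm_sq using 1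
    simp
  have hcont : Continuous fun r => B * ‖f r‖ ^ 2 + B * r * (2 * inner ℝ (f r) (f' r)) := by
    fun_prop
  have hzero : ∫ r in ε..R, (B * ‖f r‖ ^ 2 + B * r * (2 * inner ℝ (f r) (f' r))) = 0 := by
    rw [intervalIntegral.integral_eq_sub_of_hasDerivAt (fun r _ => hder r)
      (hcont.intervalIntegrable _ _), h0, h1]
    simp
  rw [← hzero]
  refine intervalIntegral.integral_mono_on hR (hcont.intervalIntegrable _ _) ?_ fun r hr => ?_
  · apply ContinuousOn.intervalIntegrable
    rw [Set.uIcc_of_le hR]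
    have hne : ∀ r ∈ Set.Icc ε R, r ≠ 0 := fun r hr => (hε.trans_le hr.1).ne'
    have hne' : ∀ r ∈ Set.Icc ε R, 1 + L + ν / r ≠ 0 := fun r hr => by
      have := hε.trans_le hr.1
      positivity
    have hdiv : ∀ s : ℝ, ContinuousOn (fun r : ℝ => s / r) (Set.Icc ε R) := fun s =>
      continuousOn_const.div continuousOn_id hne
    have hκc : ContinuousOn (fun r : ℝ => ((κ / r : ℝ) : ℂ)) (Set.Icc ε R) :=
      Complex.continuous_ofReal.comp_continuousOn (hdiv κ)
    exact continuousOn_id.mul ((((hf'.continuousOn.add (hκc.mul hfc.continuousOn)).norm.pow 2).div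
      (continuousOn_const.add (hdiv ν)) hne').add
      ((continuousOn_const.sub (hdiv ν)).mul (hfc.norm.pow 2).continuousOn))
  · have hr0 : 0 < r := hε.trans_le hr.1
    have key := two_mul_inner_sub_le_normSq_div (W := 1 + L + ν / r) (by positivity) B
      (f' r + ((κ / r : ℝ) : ℂ) * f r) (f r)
    have hin : inner ℝ (f r) (f' r + ((κ / r : ℝ) : ℂ) * f r)
        = inner ℝ (f r) (f' r) + κ / r * ‖f r‖ ^ 2 := by
      rw [← Complex.real_smul, inner_add_right, real_inner_smul_right, real_inner_self_eq_norm_sq]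
    rw [hin, hB2] at key
    have hmul := mul_le_mul_of_nonneg_left key hr0.le
    have hcoef : 0 ≤ 2 * (B * (κ - 1 / 2)) - ν * (1 + b ^ 2) := by
      rw [hBκ, hcb]; nlinarith
    have hexp : r * (2 * B * (inner ℝ (f r) (f' r) + κ / r * ‖f r‖ ^ 2)
          - (1 + L + ν / r) * b ^ 2 * ‖f r‖ ^ 2) + r * ((1 - L - ν / r) * ‖f r‖ ^ 2)
        = B * ‖f r‖ ^ 2 + B * r * (2 * inner ℝ (f r) (f' r))
          + (2 * (B * (κ - 1 / 2)) - ν * (1 + b ^ 2)) * ‖f r‖ ^ 2 := by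
      have : r * ((1 - L) - b ^ 2 * (1 + L)) * ‖f r‖ ^ 2 = 0 := by rw [hb]; ring
      field_simp
      linear_combination this
    have := mul_nonneg hcoef (sq_nonneg ‖f r‖)
    rw [mul_add]
    linarith

/-- The unnormalised `n`-th Fourier coefficient on `[-π, π]`. -/
noncomputable def angCoeff (f : ℝ → ℂ) (n : ℤ) : ℂ :=
  ∫ θ in (-Real.pi)..Real.pi, Complex.exp (-(n * θ * Complex.I)) * f θ

lemma hasSum_normSq_angCoeff {f : ℝ → ℂ} (hf : Continuous f) :
    HasSum (fun n => ‖angCoeff f n‖ ^ 2)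
      (2 * Real.pi * ∫ θ in (-Real.pi)..Real.pi, ‖f θ‖ ^ 2) := by
  have hlt : -Real.pi < Real.pi := by linarith [Real.pi_pos]
  have hL2 : MemLp f 2 (volume.restrict (Set.Ioc (-Real.pi) Real.pi)) := by
    obtain ⟨C, hC⟩ := (isCompact_Icc (a := -Real.pi) (b := Real.pi)).exists_bound_of_continuousOn
      hf.continuousOn
    exact .of_bound hf.aestronglyMeasurable C ((ae_restrict_iff' measurableSet_Ioc).2
      (.of_forall fun θ hθ => hC θ (Set.Ioc_subset_Icc_self hθ)))
  have h := (hasSum_sq_fourierCoeffOn hlt hL2).mul_left ((2 * Real.pi) ^ 2)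
  convert! h using 1
  · ext n
    have : angCoeff f n = (2 * Real.pi : ℝ) • fourierCoeffOn hlt f n := by
      rw [fourierCoeffOn_eq_integral, smul_smul, angCoeff]
      have hT : 2 * Real.pi * (1 / (Real.pi - -Real.pi)) = 1 := by
        field_simp; ring
      rw [hT, one_smul]
      refine intervalIntegral.integral_congr fun θ _ => ?_
      simp only [fourier_coe_apply, smul_eq_mul]
      congr 2
      push_cast
      field_simp
      ring
    rw [this, norm_smul, mul_pow, Real.norm_eq_abs, sq_abs]
  · rw [smul_eq_mul]
    field_simp
    ring

lemma angCoeff_add {f g : ℝ → ℂ} (hf : Continuous f) (hg : Continuous g) (n : ℤ) :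
    angCoeff (fun θ => f θ + g θ) n = angCoeff f n + angCoeff g n := by
  simp only [angCoeff, mul_add]
  exact intervalIntegral.integral_add (Continuous.intervalIntegrable (by fun_prop) _ _)
    (Continuous.intervalIntegrable (by fun_prop) _ _)

lemma angCoeff_const_mul (c : ℂ) (f : ℝ → ℂ) (n : ℤ) :
    angCoeff (fun θ => c * f θ) n = c * angCoeff f n := by
  simp only [angCoeff, mul_left_comm _ c]
  exact intervalIntegral.integral_const_mul c _

lemma angCoeff_of_hasDerivAt {f f' : ℝ → ℂ} (hf : ∀ θ, HasDerivAt f (f' θ) θ)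
    (hf' : Continuous f') (hper : f Real.pi = f (-Real.pi)) (n : ℤ) :
    angCoeff f' n = n * Complex.I * angCoeff f n := by
  have hfc : Continuous f := continuous_iff_continuousAt.2 fun r => (hf r).continuousAt
  have hexp : ∀ θ : ℝ, HasDerivAt (fun θ : ℝ => Complex.exp (-(n * θ * Complex.I)))
      (Complex.exp (-(n * θ * Complex.I)) * -(n * 1 * Complex.I)) θ := fun θ =>
    ((((hasDerivAt_id θ).ofReal_comp.const_mul (n : ℂ)).mul_const Complex.I).neg).cexp
  have hsum : angCoeff (fun θ => -(n * Complex.I) * f θ + f' θ) n = 0 := by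
    rw [angCoeff, intervalIntegral.integral_eq_sub_of_hasDerivAt
      (f := fun θ : ℝ => Complex.exp (-(n * θ * Complex.I)) * f θ) (fun θ _ => ?_)
      (Continuous.intervalIntegrable (by fun_prop) _ _)]
    · have : Complex.exp (-(n * (Real.pi : ℝ) * Complex.I))
          = Complex.exp (-(n * ((-Real.pi : ℝ) : ℂ) * Complex.I)) := by
        rw [Complex.exp_eq_exp_iff_exists_int]
        exact ⟨-n, by push_cast; ring⟩
      rw [this, hper, sub_self]
    · convert! (hexp θ).mul (hf θ) using 1
      ring
  rw [angCoeff_add (by fun_prop) hf', angCoeff_const_mul] at hsum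
  linear_combination hsum

lemma continuous_angCoeff {F : ℝ → ℝ → ℂ} (hF : Continuous F.uncurry) (n : ℤ) :
    Continuous fun r => angCoeff (F r) n := by
  refine intervalIntegral.continuous_parametric_intervalIntegral_of_continuous' ?_ _ _
  have : Continuous fun p : ℝ × ℝ => F p.1 p.2 := hF
  simp only [Function.uncurry_def]
  fun_prop

lemma hasDerivAt_angCoeff {F F' : ℝ → ℝ → ℂ} (hF : Continuous F.uncurry)
    (hF' : Continuous F'.uncurry) (hd : ∀ r θ, HasDerivAt (fun s => F s θ) (F' r θ) r)
    (n : ℤ) (r : ℝ) :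
    HasDerivAt (fun s => angCoeff (F s) n) (angCoeff (F' r) n) r := by
  have hF1 : Continuous fun p : ℝ × ℝ => F p.1 p.2 := hF
  have hF1' : Continuous fun p : ℝ × ℝ => F' p.1 p.2 := hF'
  have hsec : ∀ s, Continuous fun θ : ℝ => Complex.exp (-(n * θ * Complex.I)) * F s θ := fun s =>
    (by fun_prop : Continuous fun θ : ℝ => Complex.exp (-(n * θ * Complex.I))).mul
      (hF1.comp (Continuous.prodMk_right s))
  have hsec' : ∀ s, Continuous fun θ : ℝ => Complex.exp (-(n * θ * Complex.I)) * F' s θ := fun s =>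
    (by fun_prop : Continuous fun θ : ℝ => Complex.exp (-(n * θ * Complex.I))).mul
      (hF1'.comp (Continuous.prodMk_right s))
  have hjoint : Continuous fun p : ℝ × ℝ => Complex.exp (-(n * p.2 * Complex.I)) * F' p.1 p.2 := by
    fun_prop
  obtain ⟨C, hC⟩ := ((isCompact_closedBall r 1).prod
    (isCompact_Icc (a := -Real.pi) (b := Real.pi))).exists_bound_of_continuousOn hjoint.continuousOn
  refine (intervalIntegral.hasDerivAt_integral_of_dominated_loc_of_deriv_le (bound := fun _ => C)
    (Metric.closedBall_mem_nhds r one_pos)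
    (.of_forall fun s => (hsec s).aestronglyMeasurable) ((hsec r).intervalIntegrable _ _)
    (hsec' r).aestronglyMeasurable (.of_forall fun θ hθ s hs => ?_) intervalIntegrable_const
    (.of_forall fun θ _ s _ => (hd s θ).const_mul _)).2
  rw [Set.uIoc_of_le (by linarith [Real.pi_pos])] at hθ
  exact hC (s, θ) ⟨hs, hθ.1.le, hθ.2⟩

/-- The Dirac–Coulomb Hardy inequality in polar coordinates, for a function `F r θ` with radial
derivative `Fr` and angular derivative `Ft`. -/
lemma polar_hardy {ν a c L b ε R : ℝ} (hν : 0 < ν) (hL : 0 ≤ L)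
    (hb : b ^ 2 * (1 + L) = 1 - L) (hcb : ν * (1 + b ^ 2) = 2 * c * b) (hb0 : 0 ≤ b)
    (hκ : ∀ n : ℤ, c ≤ |n - a - 1 / 2|) (hε : 0 < ε) (hR : ε ≤ R) {F Fr Ft : ℝ → ℝ → ℂ}
    (hF : Continuous F.uncurry) (hFr : Continuous Fr.uncurry) (hFt : Continuous Ft.uncurry)
    (hdr : ∀ r θ, HasDerivAt (fun s => F s θ) (Fr r θ) r)
    (hdt : ∀ r θ, HasDerivAt (F r) (Ft r θ) θ) (hper : ∀ r, F r Real.pi = F r (-Real.pi))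
    (h0 : ∀ θ, F ε θ = 0) (h1 : ∀ θ, F R θ = 0) :
    0 ≤ ∫ r in ε..R, ∫ θ in (-Real.pi)..Real.pi,
      r * (‖Fr r θ + (-(Complex.I / r) * Ft r θ + -(a / r : ℂ) * F r θ)‖ ^ 2 / (1 + L + ν / r)
        + (1 - L - ν / r) * ‖F r θ‖ ^ 2) := by
  have sec : ∀ {G : ℝ → ℝ → ℂ}, Continuous G.uncurry → ∀ r, Continuous (G r) := fun hG r =>
    hG.comp (Continuous.prodMk_right r)
  set D : ℝ → ℝ → ℂ := fun r θ => Fr r θ + (-(Complex.I / r) * Ft r θ + -(a / r : ℂ) * F r θ)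
    with hDdef
  have hD : ∀ r, Continuous (D r) := fun r =>
    (sec hFr r).add ((continuous_const.mul (sec hFt r)).add (continuous_const.mul (sec hF r)))
  have hDn : ∀ r n, angCoeff (D r) n
      = angCoeff (Fr r) n + (((n - a) / r : ℝ) : ℂ) * angCoeff (F r) n := by
    intro r n
    have hFt' : Continuous fun θ => -(Complex.I / r) * Ft r θ := continuous_const.mul (sec hFt r)
    have hF' : Continuous fun θ => -(a / r : ℂ) * F r θ := continuous_const.mul (sec hF r)
    simp only [hDdef]
    rw [angCoeff_add (sec hFr r) (g := fun θ => -(Complex.I / r) * Ft r θ + -(a / r : ℂ) * F r θ)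
      (hFt'.add hF'),
      angCoeff_add hFt' hF', angCoeff_const_mul, angCoeff_const_mul,
      angCoeff_of_hasDerivAt (hdt r) (sec hFt r) (hper r)]
    push_cast
    linear_combination (-(n : ℂ) / r * angCoeff (F r) n) * Complex.I_mul_I
  have hpos : ∀ r ∈ Set.uIoc ε R, 0 < r := fun r hr => by
    rw [Set.uIoc_of_le hR] at hr
    exact hε.trans hr.1
  set M : (ℝ → ℂ) → ℝ := fun f => 2 * Real.pi * ∫ θ in (-Real.pi)..Real.pi, ‖f θ‖ ^ 2 with hM
  have hsum : HasSum (fun n : ℤ => ∫ r in ε..R, r * (‖angCoeff (D r) n‖ ^ 2 / (1 + L + ν / r)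
        + (1 - L - ν / r) * ‖angCoeff (F r) n‖ ^ 2))
      (∫ r in ε..R, r * (M (D r) / (1 + L + ν / r) + (1 - L - ν / r) * M (F r))) := by
    have hB : ∀ r, HasSum (fun n : ℤ => |r| * (‖angCoeff (D r) n‖ ^ 2 / |1 + L + ν / r|
        + |1 - L - ν / r| * ‖angCoeff (F r) n‖ ^ 2))
        (|r| * (M (D r) / |1 + L + ν / r| + |1 - L - ν / r| * M (F r))) := fun r =>
      (((hasSum_normSq_angCoeff (hD r)).div_const _).add
        ((hasSum_normSq_angCoeff (sec hF r)).mul_left _)).mul_left _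
    refine intervalIntegral.hasSum_integral_of_dominated_convergence
      (fun n r => |r| * (‖angCoeff (D r) n‖ ^ 2 / |1 + L + ν / r|
        + |1 - L - ν / r| * ‖angCoeff (F r) n‖ ^ 2)) (fun n => ?_)
      (fun n => .of_forall fun r hr => ?_) (.of_forall fun r _ => (hB r).summable) ?_
      (.of_forall fun r _ => (((hasSum_normSq_angCoeff (hD r)).div_const _).add
        ((hasSum_normSq_angCoeff (sec hF r)).mul_left _)).mul_left _)
    · simp only [hDn]
      have := (continuous_angCoeff hF n).measurable
      have := (continuous_angCoeff hFr n).measurable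
      exact Measurable.aestronglyMeasurable (by fun_prop)
    · rw [Real.norm_eq_abs, abs_mul]
      refine mul_le_mul_of_nonneg_left ((abs_add_le _ _).trans_eq ?_) (abs_nonneg _)
      rw [abs_div, abs_mul, abs_of_nonneg (sq_nonneg ‖_‖), abs_of_nonneg (sq_nonneg ‖_‖)]
    · simp only [(hB _).tsum_eq]
      apply ContinuousOn.intervalIntegrable
      rw [Set.uIcc_of_le hR]
      have hne : ∀ r ∈ Set.Icc ε R, r ≠ 0 := fun r hr => (hε.trans_le hr.1).ne'
      have hdiv : ContinuousOn (fun r : ℝ => ν / r) (Set.Icc ε R) :=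
        continuousOn_const.div continuousOn_id hne
      have hMcont : ∀ {G : ℝ → ℝ → ℂ}, Continuous G.uncurry → Continuous fun r => M (G r) :=
        fun {G} hG => by
          have hG' : Continuous fun p : ℝ × ℝ => G p.1 p.2 := hG
          refine continuous_const.mul
            (intervalIntegral.continuous_parametric_intervalIntegral_of_continuous' ?_ _ _)
          simp only [Function.uncurry_def]
          fun_prop
      have hMD : ContinuousOn (fun r => M (D r)) (Set.Icc ε R) := by
        have hinv : Continuous fun p : ℝ × ℝ => (((max p.1 ε : ℝ)⁻¹ : ℝ) : ℂ) :=
          Complex.continuous_ofReal.comp ((continuous_fst.max continuous_const).inv₀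
            fun p => (hε.trans_le (le_max_right _ _)).ne')
        have hG : Continuous (fun r θ => Fr r θ + (-(Complex.I * (((max r ε : ℝ)⁻¹ : ℝ) : ℂ)) * Ft r θ
            + -((a : ℂ) * (((max r ε : ℝ)⁻¹ : ℝ) : ℂ)) * F r θ)).uncurry :=
          hFr.add (((continuous_const.mul hinv).neg.mul hFt).add
            ((continuous_const.mul hinv).neg.mul hF))
        refine (hMcont hG).continuousOn.congr fun r hr => ?_
        simp only [hDdef, max_eq_left hr.1, Complex.ofReal_inv, div_eq_mul_inv]
      have hw : ∀ r ∈ Set.Icc ε R, |1 + L + ν / r| ≠ 0 := fun r hr => by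
        have := hε.trans_le hr.1
        positivity
      exact continuousOn_id.abs.mul ((hMD.div (continuousOn_const.add hdiv).abs hw).add
        ((continuousOn_const.sub hdiv).abs.mul (hMcont hF).continuousOn))
  have hchan : ∀ n : ℤ, 0 ≤ ∫ r in ε..R, r * (‖angCoeff (D r) n‖ ^ 2 / (1 + L + ν / r)
        + (1 - L - ν / r) * ‖angCoeff (F r) n‖ ^ 2) := fun n => by
    simp only [hDn]
    exact radial_hardy hν hL hb hcb hb0 (hκ n) hε hR (hasDerivAt_angCoeff hF hFr hdr n)
      (continuous_angCoeff hFr n) (by simp [angCoeff, h0]) (by simp [angCoeff, h1])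
  have htot := hsum.nonneg hchan
  have hfac : ∫ r in ε..R, r * (M (D r) / (1 + L + ν / r) + (1 - L - ν / r) * M (F r))
      = 2 * Real.pi * ∫ r in ε..R, ∫ θ in (-Real.pi)..Real.pi,
        r * (‖D r θ‖ ^ 2 / (1 + L + ν / r) + (1 - L - ν / r) * ‖F r θ‖ ^ 2) := by
    rw [← intervalIntegral.integral_const_mul]
    refine intervalIntegral.integral_congr fun r _ => ?_
    have := hD r
    have := sec hF r
    simp only [hM]
    rw [intervalIntegral.integral_const_mul, intervalIntegral.integral_add
      (Continuous.intervalIntegrable (by fun_prop) _ _)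
      (Continuous.intervalIntegrable (by fun_prop) _ _), intervalIntegral.integral_div,
      intervalIntegral.integral_const_mul]
    ring
  rw [hfac] at htot
  exact nonneg_of_mul_nonneg_right htot (by positivity)

lemma integral_eq_polar_of_eq_zero {g : ℂ → ℝ} (hg : Continuous g) {ε R : ℝ} (hε : 0 < ε)
    (hR : ε ≤ R) (h0 : ∀ x, ‖x‖ ≤ ε → g x = 0) (h1 : ∀ x, R ≤ ‖x‖ → g x = 0) :
    ∫ x, g x = ∫ r in ε..R, ∫ θ in (-Real.pi)..Real.pi,
      r * g (r * Complex.exp (θ * Complex.I)) := by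
  have hpi : -Real.pi ≤ Real.pi := by linarith [Real.pi_pos]
  have hcont : Continuous fun p : ℝ × ℝ => p.1 * g (p.1 * Complex.exp (p.2 * Complex.I)) := by
    fun_prop
  have hnorm : ∀ r θ : ℝ, 0 < r → ‖(r : ℂ) * Complex.exp (θ * Complex.I)‖ = r := fun r θ hr => by
    rw [norm_mul, Complex.norm_exp_ofReal_mul_I, mul_one, Complex.norm_real, Real.norm_of_nonneg hr.le]
  rw [← Complex.integral_comp_polarCoord_symm]
  have hpolar : ∀ p : ℝ × ℝ, p.1 • g (Complex.polarCoord.symm p)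
      = p.1 * g (p.1 * Complex.exp (p.2 * Complex.I)) := fun p => by
    rw [Complex.polarCoord_symm_apply, Complex.exp_mul_I, smul_eq_mul, Complex.ofReal_cos,
      Complex.ofReal_sin]
  simp only [hpolar]
  have hsub : Set.Ioc ε R ×ˢ Set.Ioo (-Real.pi) Real.pi ⊆ polarCoord.target := fun p hp =>
    ⟨hε.trans hp.1.1, hp.2⟩
  rw [setIntegral_eq_of_subset_of_forall_sdiff_eq_zero
    polarCoord.open_target.measurableSet hsub fun p hp => ?_]
  · rw [Measure.volume_eq_prod, setIntegral_prod, intervalIntegral.integral_of_le hR]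
    · refine setIntegral_congr_fun measurableSet_Ioc fun r _ => ?_
      simp only
      rw [intervalIntegral.integral_of_le hpi, integral_Ioc_eq_integral_Ioo]
    · exact (hcont.continuousOn.integrableOn_compact (isCompact_Icc.prod isCompact_Icc)).mono_set
        (Set.prod_mono Set.Ioc_subset_Icc_self Set.Ioo_subset_Icc_self)
  · have hp1 : 0 < p.1 := hp.1.1
    have hn := hnorm p.1 p.2 hp1
    rcases le_or_gt p.1 ε with h | h
    · rw [h0 _ (hn.trans_le h), mul_zero]
    · rw [h1 _ (le_of_le_of_eq ?_ hn.symm), mul_zero]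
      by_contra! hlt
      exact hp.2 ⟨⟨h, hlt.le⟩, hp.1.2⟩

lemma norm_Dop_polar (a : ℝ) (χ : ℂ → ℂ) {r : ℝ} (hr : 0 < r) (θ : ℝ) :
    ‖Dop a χ (r * Complex.exp (θ * Complex.I))‖
      = ‖fderiv ℝ χ (r * Complex.exp (θ * Complex.I)) (Complex.exp (θ * Complex.I))
        + (-(Complex.I / r) * fderiv ℝ χ (r * Complex.exp (θ * Complex.I))
          (r * (Complex.exp (θ * Complex.I) * Complex.I))
        + -(a / r : ℂ) * χ (r * Complex.exp (θ * Complex.I)))‖ := by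
  set x : ℂ := r * Complex.exp (θ * Complex.I) with hx
  set e : ℂ := Complex.exp (θ * Complex.I) with he
  have hne : ‖Complex.I * e‖ = 1 := by
    rw [norm_mul, Complex.norm_I, he, Complex.norm_exp_ofReal_mul_I, one_mul]
  have hr' : (r : ℂ) ≠ 0 := Complex.ofReal_ne_zero.2 hr.ne'
  have hxn : ‖x‖ = r := by
    rw [hx, norm_mul, he, Complex.norm_exp_ofReal_mul_I, mul_one, Complex.norm_real,
      Real.norm_of_nonneg hr.le]
  have hconj : (starRingEnd ℂ) x * e = r := by
    rw [hx, map_mul, Complex.conj_ofReal, mul_assoc, ← Complex.normSq_eq_conj_mul_self,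
      Complex.normSq_eq_norm_sq, he, Complex.norm_exp_ofReal_mul_I]
    simp
  have hlin : ∀ v : ℂ, fderiv ℝ χ x v = v.re * fderiv ℝ χ x 1 + v.im * fderiv ℝ χ x Complex.I := by
    intro v
    have hv : v = v.re • (1 : ℂ) + v.im • Complex.I := by
      simp [Complex.re_add_im]
    conv_lhs => rw [hv]
    rw [map_add, map_smul, map_smul, Complex.real_smul, Complex.real_smul]
  have hre : (e.re : ℂ) + e.im * Complex.I = e := Complex.re_add_im e
  rw [← one_mul ‖Dop a χ x‖, ← hne, ← norm_mul]
  congr 1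
  rw [Dop, wirtingerZ, hxn, hlin e, hlin (r * (e * Complex.I))]
  have h1 : ((r : ℂ) * (e * Complex.I)).re = -(r * e.im) := by simp
  have h2 : ((r : ℂ) * (e * Complex.I)).im = r * e.re := by simp
  rw [h1, h2]
  push_cast
  have hpart : Complex.I * e * (Complex.I * a * ((starRingEnd ℂ) x / (r : ℂ) ^ 2) * χ x)
      = -(a / r) * χ x := by
    field_simp
    linear_combination (Complex.I ^ 2 * a * χ x) * hconj + r * a * χ x * Complex.I_sq
  rw [mul_add, hpart]
  generalize (e.re : ℂ) = c at *
  generalize (e.im : ℂ) = s at *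
  generalize fderiv ℝ χ x 1 = p
  generalize fderiv ℝ χ x Complex.I = q
  rw [← hre]
  field_simp
  linear_combination r * (-p * c - p * s * Complex.I + q * c * Complex.I
    + q * s * (Complex.I ^ 2 - 1)) * Complex.I_sq

lemma Dop_eq_zero_of_notMem_tsupport (a : ℝ) {χ : ℂ → ℂ} {x : ℂ} (hx : x ∉ tsupport χ) :
    Dop a χ x = 0 := by
  have hd : fderiv ℝ χ x = 0 := by
    by_contra h
    exact hx (support_fderiv_subset ℝ h)
  simp [Dop, wirtingerZ, hd, image_eq_zero_of_notMem_tsupport hx]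

lemma continuousOn_Dop (a : ℝ) {χ : ℂ → ℂ} (hχ : ContDiff ℝ 1 χ) :
    ContinuousOn (Dop a χ) {0}ᶜ := by
  have hd : Continuous (fderiv ℝ χ) := hχ.continuous_fderiv one_ne_zero
  have hc := hχ.continuous
  have hw : Continuous (wirtingerZ χ) := by
    unfold wirtingerZ
    fun_prop
  have hq : ContinuousOn (fun x : ℂ => (starRingEnd ℂ) x / (‖x‖ : ℂ) ^ 2) {0}ᶜ :=
    Complex.continuous_conj.continuousOn.div
      (by fun_prop) fun x hx => pow_ne_zero 2 (Complex.ofReal_ne_zero.2 (norm_ne_zero_iff.2 hx))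
  exact (continuous_const.mul hw).continuousOn.add
    ((continuousOn_const.mul hq).mul hc.continuousOn)

theorem stmt17 (ν a : ℝ) (hν : ν ∈ Set.Ioc (0 : ℝ) (1/2)) (ha : a ∈ Set.Ioc (0 : ℝ) (1/2 - ν))
    (χ : ℂ → ℂ) (hs : ContDiff ℝ (⊤ : ℕ∞) χ) (hc : HasCompactSupport χ) (h0 : (0 : ℂ) ∉ tsupport χ) :
    ∫ x : ℂ, (‖Dop a χ x‖^2 / (1 + Real.sqrt ((1/2 - a)^2 - ν^2) / (1/2 - a) + ν/‖x‖)
        + (1 - Real.sqrt ((1/2 - a)^2 - ν^2) / (1/2 - a) - ν/‖x‖) * ‖χ x‖^2) ≥ 0 := by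
  obtain ⟨hν0, -⟩ := hν
  obtain ⟨ha0, ha1⟩ := ha
  set c : ℝ := 1 / 2 - a with hcdef
  have hcpos : 0 < c := by linarith
  have hrad : 0 ≤ c ^ 2 - ν ^ 2 := by nlinarith
  set L : ℝ := Real.sqrt (c ^ 2 - ν ^ 2) / c with hLdef
  have hL : 0 ≤ L := by positivity
  have hL2 : c ^ 2 * (1 - L ^ 2) = ν ^ 2 := by
    rw [hLdef, div_pow, Real.sq_sqrt hrad]
    field_simp
    ring
  have hL1 : L ≤ 1 := by
    by_contra! h
    have hsq : 0 < L ^ 2 - 1 := by nlinarith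
    nlinarith [mul_pos (pow_pos hcpos 2) hsq]
  have hχ1 : ContDiff ℝ 1 χ := hs.of_le (by exact_mod_cast le_top)
  have hχc : Continuous χ := hχ1.continuous
  have hdχ : Continuous (fderiv ℝ χ) := hχ1.continuous_fderiv one_ne_zero
  obtain ⟨δ, hδ, hball⟩ := Metric.isOpen_iff.1 (isClosed_tsupport χ).isOpen_compl 0 h0
  obtain ⟨S, hS⟩ := hc.isCompact.isBounded.subset_ball (0 : ℂ)
  set ε : ℝ := δ / 2 with hεdef
  have hε : 0 < ε := by positivity
  set R : ℝ := max S ε with hRdef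
  have hin : ∀ x : ℂ, ‖x‖ ≤ ε → x ∉ tsupport χ := fun x hx =>
    hball (mem_ball_zero_iff.2 (by linarith))
  have hout : ∀ x : ℂ, R ≤ ‖x‖ → x ∉ tsupport χ := fun x hx hmem => by
    have := mem_ball_zero_iff.1 (hS hmem)
    linarith [le_max_left S ε]
  have hzero : ∀ x : ℂ, x ∉ tsupport χ → ‖Dop a χ x‖ ^ 2 / (1 + L + ν / ‖x‖)
      + (1 - L - ν / ‖x‖) * ‖χ x‖ ^ 2 = 0 := fun x hx => by
    simp [Dop_eq_zero_of_notMem_tsupport a hx, image_eq_zero_of_notMem_tsupport hx]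
  have hcont : Continuous fun x : ℂ => ‖Dop a χ x‖ ^ 2 / (1 + L + ν / ‖x‖)
      + (1 - L - ν / ‖x‖) * ‖χ x‖ ^ 2 := by
    refine continuous_iff_continuousAt.2 fun x => ?_
    rcases eq_or_ne x 0 with rfl | hx
    · have hev : (fun x : ℂ => ‖Dop a χ x‖ ^ 2 / (1 + L + ν / ‖x‖)
          + (1 - L - ν / ‖x‖) * ‖χ x‖ ^ 2) =ᶠ[nhds 0] fun _ => 0 :=
        Filter.eventually_of_mem ((isClosed_tsupport χ).isOpen_compl.mem_nhds h0) hzero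
      exact continuousAt_const.congr hev.symm
    · have hx0 : ‖x‖ ≠ 0 := norm_ne_zero_iff.2 hx
      have hD : ContinuousAt (Dop a χ) x :=
        (continuousOn_Dop a hχ1).continuousAt (isOpen_compl_singleton.mem_nhds hx)
      have hdiv : ContinuousAt (fun x : ℂ => ν / ‖x‖) x :=
        continuousAt_const.div continuous_norm.continuousAt hx0
      have hw : 1 + L + ν / ‖x‖ ≠ 0 := by positivity
      exact ((hD.norm.pow 2).div (continuousAt_const.add hdiv) hw).add
        ((continuousAt_const.sub hdiv).mul (hχc.norm.pow 2).continuousAt)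
  have hεR : ε ≤ R := le_max_right _ _
  rw [ge_iff_le, integral_eq_polar_of_eq_zero hcont hε hεR (fun x hx => hzero x (hin x hx))
    (fun x hx => hzero x (hout x hx))]
  have hnorm : ∀ r θ : ℝ, 0 ≤ r → ‖(r : ℂ) * Complex.exp (θ * Complex.I)‖ = r := fun r θ hr => by
    rw [norm_mul, Complex.norm_exp_ofReal_mul_I, mul_one, Complex.norm_real, Real.norm_of_nonneg hr]
  have hdiff : ∀ x, HasFDerivAt χ (fderiv ℝ χ x) x := fun x =>
    (hχ1.differentiable one_ne_zero x).hasFDerivAt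
  have hκ : ∀ n : ℤ, c ≤ |(n : ℝ) - a - 1 / 2| := fun n => by
    rcases le_or_gt n 0 with hn | hn
    · have : (n : ℝ) ≤ 0 := by exact_mod_cast hn
      exact le_abs.2 (.inr (by linarith))
    · have : (1 : ℝ) ≤ n := by exact_mod_cast hn
      exact le_abs.2 (.inl (by linarith))
  have hb : ((1 - L) * c / ν) ^ 2 * (1 + L) = 1 - L := by
    field_simp
    linear_combination (1 - L) * hL2
  have hcb : ν * (1 + ((1 - L) * c / ν) ^ 2) = 2 * c * ((1 - L) * c / ν) := by
    field_simp
    linear_combination -hL2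
  have hb0 : 0 ≤ (1 - L) * c / ν := by
    have := sub_nonneg.2 hL1
    positivity
  have main := polar_hardy hν0 hL hb hcb hb0 hκ hε hεR
    (F := fun r θ => χ (r * Complex.exp (θ * Complex.I)))
    (Fr := fun r θ => fderiv ℝ χ (r * Complex.exp (θ * Complex.I)) (Complex.exp (θ * Complex.I)))
    (Ft := fun r θ => fderiv ℝ χ (r * Complex.exp (θ * Complex.I))
      (r * (Complex.exp (θ * Complex.I) * Complex.I)))
    (by simp only [Function.uncurry_def]; fun_prop) (by simp only [Function.uncurry_def]; fun_prop)
    (by simp only [Function.uncurry_def]; fun_prop)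
    (fun r θ => (hdiff _).comp_hasDerivAt r
      (by simpa using (hasDerivAt_id r).ofReal_comp.mul_const (Complex.exp (θ * Complex.I))))
    (fun r θ => (hdiff _).comp_hasDerivAt θ
      (by simpa using ((((hasDerivAt_id θ).ofReal_comp.mul_const Complex.I).cexp).const_mul (r : ℂ))))
    (fun r => by simp [Complex.exp_neg, Complex.exp_pi_mul_I])
    (fun θ => image_eq_zero_of_notMem_tsupport (hin _ (hnorm _ _ hε.le).le))
    (fun θ => image_eq_zero_of_notMem_tsupport (hout _ (hnorm _ _ (hε.le.trans hεR)).ge))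
  refine main.trans_eq (intervalIntegral.integral_congr fun r hr => ?_)
  rw [Set.uIcc_of_le hεR] at hr
  have hr0 : 0 < r := hε.trans_le hr.1
  refine intervalIntegral.integral_congr fun θ _ => ?_
  rw [norm_Dop_polar a χ hr0, hnorm r θ hr0.le]
end

section
/- Let a ∈ (0,1/2) and ν ∈ (0, 1/2 − a]. Then for every η ∈ C_c^∞(ℝ²∖{0},ℂ), ∫_{ℝ²} ( (4/ν) |x| |∂_z η(x)|² + 2 |η(x)|² ) |x|^{2a} dx ≥ ν ∫_{ℝ²} |η(x)|² |x|^{2a−1} dx. -/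
open MeasureTheory

open Real ComplexConjugate

lemma circle_spectral_gap {c : ℝ} (hc : c ∈ Set.Icc (1/2 : ℝ) 1) {w w' : ℝ → ℂ}
    (hw : ∀ x, HasDerivAt w (w' x) x) (hw' : Continuous w') (hper : w π = w (-π)) :
    (1 - c)^2 * ∫ x in (-π)..π, ‖w x‖^2 ≤ ∫ x in (-π)..π, ‖-Complex.I * w' x - c * w x‖^2 := by
  have hwc : Continuous w := continuous_iff_continuousAt.2 fun x => (hw x).continuousAt
  have hab : -π < π := by linarith [pi_pos]
  have hL2 : ∀ f : ℝ → ℂ, Continuous f → MemLp f 2 (volume.restrict (Set.Ioc (-π) π)) := by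
    intro f hf
    rw [memLp_two_iff_integrable_sq_norm hf.aestronglyMeasurable]
    exact (hf.norm.pow 2).integrableOn_Ioc
  have hg : Continuous fun x => -Complex.I * w' x - c * w x := by fun_prop
  have hderiv : ∀ n : ℤ, fourierCoeffOn hab w' n = Complex.I * n * fourierCoeffOn hab w n := by
    intro n
    rcases eq_or_ne n 0 with rfl | hn
    · rw [fourierCoeffOn_eq_integral]
      have := intervalIntegral.integral_eq_sub_of_hasDerivAt (a := -π) (b := π)
        (fun x _ => hw x) (hw'.intervalIntegrable _ _)
      simp [this, hper]
    · rw [fourierCoeffOn_of_hasDerivAt hab hn (fun x _ => hw x) (hw'.intervalIntegrable _ _), hper]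
      have : (n : ℂ) ≠ 0 := by exact_mod_cast hn
      have h2 : (π : ℂ) ≠ 0 := by exact_mod_cast pi_ne_zero
      field_simp
      push_cast
      ring_nf
  have hcoeff : ∀ n : ℤ, fourierCoeffOn hab (fun x => -Complex.I * w' x - c * w x) n
      = (n - c) * fourierCoeffOn hab w n := by
    intro n
    have hsub : fourierCoeffOn hab (fun x => -Complex.I * w' x - c * w x) n
        = fourierCoeffOn hab (fun x => -Complex.I * w' x) n
          - fourierCoeffOn hab (fun x => (c : ℂ) * w x) n := by
      simp only [fourierCoeffOn_eq_integral]
      rw [← smul_sub, ← intervalIntegral.integral_sub]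
      · simp only [smul_sub]
      all_goals
        apply Continuous.intervalIntegrable
        have : Continuous fun x : ℝ => fourier (-n) (x : AddCircle (π - -π)) :=
          (map_continuous _).comp (AddCircle.continuous_mk' _)
        exact this.smul (by fun_prop)
    rw [hsub, fourierCoeffOn.const_mul, fourierCoeffOn.const_mul, hderiv]
    linear_combination (-(n : ℂ) * fourierCoeffOn hab w n) * Complex.I_sq
  have h1 := (hasSum_sq_fourierCoeffOn hab (hL2 w hwc)).mul_left ((1 - c)^2)
  have h2 := hasSum_sq_fourierCoeffOn hab (hL2 _ hg)
  have h3 := hasSum_le (fun n => ?_) h1 h2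
  · simp only [smul_eq_mul] at h3
    rw [mul_left_comm] at h3
    exact le_of_mul_le_mul_left h3 (inv_pos.2 (by linarith))
  · rw [hcoeff, norm_mul, mul_pow]
    refine mul_le_mul_of_nonneg_right ?_ (sq_nonneg _)
    have : ‖(n : ℂ) - c‖ ^ 2 = ((n : ℝ) - c)^2 := by
      rw [← sq_abs ((n : ℝ) - c), ← Real.norm_eq_abs, ← Complex.norm_real]
      push_cast
      rfl
    rw [this]
    obtain ⟨hc1, hc2⟩ := hc
    rcases le_or_gt n 0 with hn | hn
    · have : (n : ℝ) ≤ 0 := by exact_mod_cast hn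
      nlinarith
    · have : (1 : ℝ) ≤ n := by exact_mod_cast hn
      nlinarith

lemma intervalIntegral_swap_of_continuous {f : ℝ → ℝ → ℂ} (hf : Continuous (Function.uncurry f))
    {a b c d : ℝ} (hab : a ≤ b) (hcd : c ≤ d) :
    ∫ x in a..b, ∫ y in c..d, f x y = ∫ y in c..d, ∫ x in a..b, f x y := by
  simp only [intervalIntegral.integral_of_le hab, intervalIntegral.integral_of_le hcd]
  apply integral_integral_swap
  rw [Measure.prod_restrict]
  exact (hf.continuousOn.integrableOn_compact (isCompact_Icc.prod isCompact_Icc)).mono_set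
    (Set.prod_mono Set.Ioc_subset_Icc_self Set.Ioc_subset_Icc_self)

lemma cylinder_spectral_gap {c s T : ℝ} (hc : c ∈ Set.Icc (1/2 : ℝ) 1) (hsT : s ≤ T)
    {u p v q : ℝ → ℝ → ℂ} (hu : Continuous (Function.uncurry u))
    (hp : Continuous (Function.uncurry p)) (hv : Continuous (Function.uncurry v))
    (hq : Continuous (Function.uncurry q))
    (hut : ∀ t θ, HasDerivAt (fun x => u x θ) (p t θ) t)
    (huθ : ∀ t θ, HasDerivAt (u t) (v t θ) θ)
    (hvt : ∀ t θ, HasDerivAt (fun x => v x θ) (q t θ) t)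
    (hpθ : ∀ t θ, HasDerivAt (p t) (q t θ) θ)
    (hs : ∀ θ, u s θ = 0) (hT : ∀ θ, u T θ = 0)
    (huper : ∀ t, u t π = u t (-π)) (hpper : ∀ t, p t π = p t (-π)) :
    (1 - c)^2 * ∫ t in s..T, ∫ θ in (-π)..π, ‖u t θ‖^2 ≤
      ∫ t in s..T, ∫ θ in (-π)..π, ‖p t θ - Complex.I * v t θ - c * u t θ‖^2 := by
  have hab : -π ≤ π := by linarith [pi_pos]
  have hcomp : ∀ {E : Type} [TopologicalSpace E] {f : ℝ → ℝ → E}, Continuous (Function.uncurry f) →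
      Continuous (fun z : ℝ × ℝ => f z.1 z.2) := fun h => h
  have hu2 := hcomp hu
  have hp2 := hcomp hp
  have hv2 := hcomp hv
  have hq2 := hcomp hq
  let Φ : ℝ → ℝ → ℂ := fun t θ => Complex.I * (u t θ * conj (v t θ)) - c * (u t θ * conj (u t θ))
  let Φ' : ℝ → ℝ → ℂ := fun t θ =>
    Complex.I * (p t θ * conj (v t θ) + u t θ * conj (q t θ))
      - c * (p t θ * conj (u t θ) + u t θ * conj (p t θ))
  let Ψ : ℝ → ℝ → ℂ := fun t θ => Complex.I * (u t θ * conj (p t θ))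
  let Ψ' : ℝ → ℝ → ℂ := fun t θ =>
    Complex.I * (v t θ * conj (p t θ) + u t θ * conj (q t θ))
  let Q : ℝ → ℝ → ℂ := fun t θ => -Complex.I * v t θ - c * u t θ
  let X : ℝ → ℝ → ℝ := fun t θ => 2 * (p t θ * conj (Q t θ)).re
  have hΦ'c : Continuous (Function.uncurry Φ') := by
    simp only [Φ', Function.uncurry_def]
    fun_prop
  have hΨ'c : Continuous (Function.uncurry Ψ') := by
    simp only [Ψ', Function.uncurry_def]
    fun_prop
  have hQc : Continuous (Function.uncurry Q) := by
    simp only [Q, Function.uncurry_def]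
    fun_prop
  have hQ2 := hcomp hQc
  have hXc : Continuous (Function.uncurry X) := by
    simp only [X, Function.uncurry_def]
    exact continuous_const.mul (Complex.continuous_re.comp (by fun_prop))
  have hΦ : ∀ t θ, HasDerivAt (fun x => Φ x θ) (Φ' t θ) t := fun t θ =>
    (((hut t θ).mul (hvt t θ).star).const_mul Complex.I).sub
      (((hut t θ).mul (hut t θ).star).const_mul (c : ℂ))
  have hΨ : ∀ t θ, HasDerivAt (Ψ t) (Ψ' t θ) θ := fun t θ =>
    (((huθ t θ).mul (hpθ t θ).star).const_mul Complex.I)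
  have hinnerR : ∀ {f : ℝ → ℝ → ℝ}, Continuous (Function.uncurry f) →
      Continuous fun t => ∫ θ in (-π)..π, f t θ := fun h =>
    intervalIntegral.continuous_parametric_intervalIntegral_of_continuous' h _ _
  have hslice : ∀ {E : Type} [TopologicalSpace E] {f : ℝ → ℝ → E}, Continuous (Function.uncurry f) →
      ∀ t, Continuous (f t) := fun h t => h.comp (by fun_prop : Continuous fun θ => (t, θ))
  have hslice' : ∀ {E : Type} [TopologicalSpace E] {f : ℝ → ℝ → E}, Continuous (Function.uncurry f) →
      ∀ θ, Continuous fun t => f t θ := fun h θ => h.comp (by fun_prop : Continuous fun t => (t, θ))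
  have hΦ0 : ∫ t in s..T, ∫ θ in (-π)..π, Φ' t θ = 0 := by
    rw [intervalIntegral_swap_of_continuous hΦ'c hsT hab]
    have : ∀ θ, ∫ t in s..T, Φ' t θ = 0 := by
      intro θ
      rw [intervalIntegral.integral_eq_sub_of_hasDerivAt (fun t _ => hΦ t θ)
        ((hslice' hΦ'c θ).intervalIntegrable _ _)]
      simp [Φ, hs, hT]
    simp [this]
  have hΨ0 : ∀ t, ∫ θ in (-π)..π, Ψ' t θ = 0 := by
    intro t
    rw [intervalIntegral.integral_eq_sub_of_hasDerivAt (fun θ _ => hΨ t θ)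
      ((hslice hΨ'c t).intervalIntegrable _ _)]
    simp [Ψ, huper, hpper]
  have hX : ∀ t θ, (X t θ : ℂ) = Φ' t θ - Ψ' t θ := by
    intro t θ
    have : (X t θ : ℂ) = p t θ * conj (Q t θ) + conj (p t θ * conj (Q t θ)) := by
      rw [Complex.add_conj]
    rw [this]
    simp [Φ', Ψ', Q]
    ring
  have hX0 : ∫ t in s..T, ∫ θ in (-π)..π, X t θ = 0 := by
    rw [← Complex.ofReal_inj, ← intervalIntegral.integral_ofReal]
    simp_rw [← intervalIntegral.integral_ofReal, hX]
    have : ∀ t, ∫ θ in (-π)..π, (Φ' t θ - Ψ' t θ) = ∫ θ in (-π)..π, Φ' t θ := by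
      intro t
      rw [intervalIntegral.integral_sub ((hslice hΦ'c t).intervalIntegrable _ _)
        ((hslice hΨ'c t).intervalIntegrable _ _), hΨ0, sub_zero]
    simp [this, hΦ0]
  have hnQ : Continuous (Function.uncurry fun t θ => ‖Q t θ‖^2) := hQc.norm.pow 2
  have hnU : Continuous (Function.uncurry fun t θ => ‖u t θ‖^2) := hu.norm.pow 2
  have hnP : Continuous (Function.uncurry fun t θ => ‖p t θ - Complex.I * v t θ - c * u t θ‖^2) :=
    ((hp.sub (continuous_const.mul hv)).sub (continuous_const.mul hu)).norm.pow 2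
  calc (1 - c)^2 * ∫ t in s..T, ∫ θ in (-π)..π, ‖u t θ‖^2
      = ∫ t in s..T, (1 - c)^2 * ∫ θ in (-π)..π, ‖u t θ‖^2 := by
        rw [intervalIntegral.integral_const_mul]
    _ ≤ ∫ t in s..T, ∫ θ in (-π)..π, ‖Q t θ‖^2 :=
        intervalIntegral.integral_mono hsT
          ((continuous_const.mul (hinnerR hnU)).intervalIntegrable _ _)
          ((hinnerR hnQ).intervalIntegrable _ _)
          fun t => circle_spectral_gap hc (huθ t) (hslice hv t) (huper t)
    _ = ∫ t in s..T, ((∫ θ in (-π)..π, ‖Q t θ‖^2) + ∫ θ in (-π)..π, X t θ) := by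
        rw [intervalIntegral.integral_add ((hinnerR hnQ).intervalIntegrable _ _)
          ((hinnerR hXc).intervalIntegrable _ _), hX0, add_zero]
    _ ≤ _ := by
        refine intervalIntegral.integral_mono hsT
          (((hinnerR hnQ).add (hinnerR hXc)).intervalIntegrable _ _)
          ((hinnerR hnP).intervalIntegrable _ _) fun t => ?_
        dsimp only
        rw [← intervalIntegral.integral_add ((hslice hnQ t).intervalIntegrable _ _)
          ((hslice hXc t).intervalIntegrable _ _)]
        refine intervalIntegral.integral_mono hab
          (((hslice hnQ t).add (hslice hXc t)).intervalIntegrable _ _)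
          ((hslice hnP t).intervalIntegrable _ _) fun θ => ?_
        have h1 : p t θ - Complex.I * v t θ - c * u t θ = p t θ + Q t θ := by
          simp only [Q]; ring
        simp only [h1, X]
        rw [Complex.sq_norm (p t θ + Q t θ), Complex.normSq_add, ← Complex.sq_norm,
          ← Complex.sq_norm]
        nlinarith [sq_nonneg ‖p t θ‖]

lemma integral_eq_exp_cylinder {g : ℂ → ℝ} (hg : Continuous g) {s T : ℝ} (hsT : s ≤ T)
    (hin : ∀ x, ‖x‖ ≤ exp s → g x = 0) (hout : ∀ x, exp T < ‖x‖ → g x = 0) :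
    ∫ x, g x = ∫ t in s..T, ∫ θ in (-π)..π, exp (2 * t) * g (Complex.exp (t + θ * Complex.I)) := by
  have hab : -π ≤ π := by linarith [pi_pos]
  let G : ℝ → ℝ → ℝ := fun r θ => r * g (r * (Real.cos θ + Real.sin θ * Complex.I))
  have hG : Continuous (Function.uncurry G) := by
    simp only [G, Function.uncurry_def]
    fun_prop
  have hGint : Continuous fun r => ∫ θ in (-π)..π, G r θ :=
    intervalIntegral.continuous_parametric_intervalIntegral_of_continuous' hG _ _
  have hnorm : ∀ r θ : ℝ, 0 < r → ‖(r : ℂ) * (Real.cos θ + Real.sin θ * Complex.I)‖ = r := by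
    intro r θ hr
    have := Complex.norm_polarCoord_symm (r, θ)
    rw [Complex.polarCoord_symm_apply] at this
    rw [this, abs_of_pos hr]
  have hsub : Set.Ioc (exp s) (exp T) ×ˢ Set.Ioo (-π) π ⊆ Set.Ioi (0 : ℝ) ×ˢ Set.Ioo (-π) π :=
    Set.prod_mono (fun r hr => (exp_pos s).trans hr.1) subset_rfl
  rw [← Complex.integral_comp_polarCoord_symm, polarCoord_target]
  simp only [Complex.polarCoord_symm_apply, smul_eq_mul]
  change ∫ z : ℝ × ℝ in _, G z.1 z.2 = _
  rw [setIntegral_eq_of_subset_of_forall_sdiff_eq_zero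
    (measurableSet_Ioi.prod measurableSet_Ioo) hsub, Measure.volume_eq_prod, setIntegral_prod]
  · simp_rw [← integral_Ioc_eq_integral_Ioo, ← intervalIntegral.integral_of_le hab]
    rw [← intervalIntegral.integral_of_le (exp_le_exp.2 hsT),
      ← intervalIntegral.integral_comp_mul_deriv (fun t _ => Real.hasDerivAt_exp t)
        Real.continuous_exp.continuousOn hGint]
    refine intervalIntegral.integral_congr fun t _ => ?_
    simp only [Function.comp]
    rw [← intervalIntegral.integral_mul_const]
    refine intervalIntegral.integral_congr fun θ _ => ?_
    simp only [G]
    rw [Complex.exp_add, Complex.exp_mul_I, two_mul, Real.exp_add]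
    push_cast
    ring
  · exact (hG.continuousOn.integrableOn_compact (isCompact_Icc.prod isCompact_Icc)).mono_set
      (Set.prod_mono Set.Ioc_subset_Icc_self Set.Ioo_subset_Icc_self)
  · rintro ⟨r, θ⟩ ⟨⟨hr, hθ⟩, hn⟩
    have hr0 : 0 < r := hr
    have : g (r * (Real.cos θ + Real.sin θ * Complex.I)) = 0 := by
      by_cases h : r ≤ exp s
      · exact hin _ (by rw [hnorm r θ hr0]; exact h)
      · refine hout _ ?_
        rw [hnorm r θ hr0]
        by_contra h'
        exact hn ⟨⟨not_le.1 h, not_lt.1 h'⟩, hθ⟩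
    simp only [G, this, mul_zero]

lemma continuous_mul_norm_rpow {f : ℂ → ℝ} (hf : Continuous f)
    (h0 : ∀ᶠ x in nhds 0, f x = 0) (b : ℝ) : Continuous fun x => f x * ‖x‖ ^ b := by
  refine continuous_iff_continuousAt.2 fun x => ?_
  rcases eq_or_ne x 0 with rfl | hx
  · refine (continuousAt_const (y := (0 : ℝ))).congr ?_
    filter_upwards [h0] with x hx
    simp [hx]
  · exact hf.continuousAt.mul
      (continuous_norm.continuousAt.rpow_const (Or.inl (norm_ne_zero_iff.2 hx)))

lemma continuous_wirtingerZ {η : ℂ → ℂ} (hη : ContDiff ℝ 1 η) : Continuous (wirtingerZ η) := by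
  have h := hη.continuous_fderiv one_ne_zero
  unfold wirtingerZ
  fun_prop

lemma fderiv_apply_self_sub {η : ℂ → ℂ} (x : ℂ) :
    fderiv ℝ η x x - Complex.I * fderiv ℝ η x (x * Complex.I) = 2 * x * wirtingerZ η x := by
  have h1 : x = x.re • (1 : ℂ) + x.im • Complex.I := by simp [Complex.re_add_im]
  have h2 : x * Complex.I = x.re • Complex.I - x.im • (1 : ℂ) := by
    apply Complex.ext <;> simp
  have e1 : fderiv ℝ η x x = x.re * fderiv ℝ η x 1 + x.im * fderiv ℝ η x Complex.I := by
    conv_lhs => rw [show fderiv ℝ η x x = fderiv ℝ η x (x.re • (1 : ℂ) + x.im • Complex.I) from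
      congrArg _ h1]
    rw [map_add, map_smul, map_smul]
    simp
  have e2 : fderiv ℝ η x (x * Complex.I)
      = x.re * fderiv ℝ η x Complex.I - x.im * fderiv ℝ η x 1 := by
    rw [h2, map_sub, map_smul, map_smul]
    simp
  have h3 : x = x.re + x.im * Complex.I := (Complex.re_add_im x).symm
  rw [e1, e2, wirtingerZ]
  generalize fderiv ℝ η x 1 = A
  generalize fderiv ℝ η x Complex.I = B
  linear_combination (-(A - Complex.I * B)) * h3 + x.im * B * Complex.I_sq

/-- The pullback of `η` to logarithmic coordinates, weighted by `exp (c * re w)`. -/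
noncomputable def logPullback (c : ℝ) (η : ℂ → ℂ) (w : ℂ) : ℂ :=
  (exp (c * w.re) : ℝ) * η (Complex.exp w)

lemma contDiff_logPullback {c : ℝ} {η : ℂ → ℂ} (hη : ContDiff ℝ 2 η) :
    ContDiff ℝ 2 (logPullback c η) := by
  have h1 : ContDiff ℝ 2 fun w : ℂ => ((exp (c * w.re) : ℝ) : ℂ) :=
    Complex.ofRealCLM.contDiff.comp
      (Real.contDiff_exp.comp (contDiff_const.mul Complex.reCLM.contDiff))
  exact h1.mul (hη.comp (Complex.contDiff_exp (𝕜 := ℝ)))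

lemma logPullback_add_two_pi_I (c : ℝ) (η : ℂ → ℂ) (w : ℂ) :
    logPullback c η (w + 2 * π * Complex.I) = logPullback c η w := by
  simp [logPullback, Complex.exp_periodic w]

lemma fderiv_logPullback_apply {c : ℝ} {η : ℂ → ℂ} (hη : Differentiable ℝ η) (w h : ℂ) :
    fderiv ℝ (logPullback c η) w h = (exp (c * w.re) : ℝ) *
      (c * h.re * η (Complex.exp w) + fderiv ℝ η (Complex.exp w) (Complex.exp w * h)) := by
  have h1 : HasFDerivAt (fun w : ℂ => exp (c * w.re)) (exp (c * w.re) • c • Complex.reCLM) w :=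
    (Complex.reCLM.hasFDerivAt.const_mul c).exp
  have h2 := Complex.ofRealCLM.hasFDerivAt.comp w h1
  have h3 := (Complex.hasDerivAt_exp w).hasFDerivAt.restrictScalars ℝ
  have h4 := (hη (Complex.exp w)).hasFDerivAt.comp w h3
  have h5 := (h2.mul h4).fderiv
  change fderiv ℝ (logPullback c η) w = _ at h5
  rw [h5]
  simp [mul_comm h]
  ring

lemma logPullback_spectral_gap {c s T : ℝ} (hc : c ∈ Set.Icc (1/2 : ℝ) 1) (hsT : s ≤ T)
    {η : ℂ → ℂ} (hη : ContDiff ℝ 2 η) (hin : ∀ x, ‖x‖ = exp s → η x = 0)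
    (hout : ∀ x, ‖x‖ = exp T → η x = 0) :
    (1 - c)^2 * ∫ t in s..T, ∫ θ in (-π)..π,
        exp (2 * c * t) * ‖η (Complex.exp (t + θ * Complex.I))‖^2 ≤
      ∫ t in s..T, ∫ θ in (-π)..π, exp (2 * c * t) *
        (4 * exp (2 * t) * ‖wirtingerZ η (Complex.exp (t + θ * Complex.I))‖^2) := by
  set U := logPullback c η with hUdef
  have hU : ContDiff ℝ 2 U := contDiff_logPullback hη
  have hU1 : ContDiff ℝ 1 (fderiv ℝ U) := hU.fderiv_right (by norm_num)
  have hUd : Differentiable ℝ U := hU.differentiable two_ne_zero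
  have hU1d : Differentiable ℝ (fderiv ℝ U) := hU1.differentiable one_ne_zero
  have hD : Continuous (fderiv ℝ U) := hU1.continuous
  have hDD : Continuous (fderiv ℝ (fderiv ℝ U)) := hU1.continuous_fderiv one_ne_zero
  let z : ℝ → ℝ → ℂ := fun t θ => t + θ * Complex.I
  have hz : Continuous (Function.uncurry z) := by
    simp only [z, Function.uncurry_def]
    fun_prop
  have hzt : ∀ t θ, HasDerivAt (fun x => z x θ) 1 t := fun t θ =>
    (Complex.ofRealCLM.hasDerivAt (x := t)).add_const _
  have hzθ : ∀ t θ, HasDerivAt (z t) Complex.I θ := fun t θ => by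
    have h := ((Complex.ofRealCLM.hasDerivAt (x := θ)).mul_const Complex.I).const_add (t : ℂ)
    rw [Complex.ofRealCLM_apply, Complex.ofReal_one, one_mul] at h
    exact h
  have hre : ∀ t θ, (z t θ).re = t := fun t θ => by simp [z]
  have hnz : ∀ t θ, ‖Complex.exp (z t θ)‖ = exp t := fun t θ => by
    rw [Complex.norm_exp, hre]
  have hzper : ∀ t, z t π = z t (-π) + 2 * π * Complex.I := fun t => by
    simp only [z]
    push_cast
    ring
  have hUper : ∀ w, U (w + 2 * π * Complex.I) = U w := logPullback_add_two_pi_I c η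
  have hDper : ∀ w, fderiv ℝ U (w + 2 * π * Complex.I) = fderiv ℝ U w := fun w => by
    rw [← fderiv_comp_add_right]
    simp only [hUper]
  have key := cylinder_spectral_gap hc hsT
    (u := fun t θ => U (z t θ)) (p := fun t θ => fderiv ℝ U (z t θ) 1)
    (v := fun t θ => fderiv ℝ U (z t θ) Complex.I)
    (q := fun t θ => fderiv ℝ (fderiv ℝ U) (z t θ) 1 Complex.I)
    (hU.continuous.comp hz) ((hD.comp hz).clm_apply continuous_const)
    ((hD.comp hz).clm_apply continuous_const)
    (((hDD.comp hz).clm_apply continuous_const).clm_apply continuous_const)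
    (fun t θ => (hUd _).hasFDerivAt.comp_hasDerivAt t (hzt t θ))
    (fun t θ => (hUd _).hasFDerivAt.comp_hasDerivAt θ (hzθ t θ))
    (fun t θ => by
      simpa using ((hU1d _).hasFDerivAt.comp_hasDerivAt t (hzt t θ)).clm_apply
        (hasDerivAt_const t Complex.I))
    (fun t θ => by
      have hsymm : IsSymmSndFDerivAt ℝ U (z t θ) :=
        hU.contDiffAt.isSymmSndFDerivAt (by simp)
      rw [hsymm.eq 1 Complex.I]
      simpa using ((hU1d _).hasFDerivAt.comp_hasDerivAt θ (hzθ t θ)).clm_apply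
        (hasDerivAt_const θ (1 : ℂ)))
    (fun θ => by simp [hUdef, logPullback, hin _ (hnz s θ)])
    (fun θ => by simp [hUdef, logPullback, hout _ (hnz T θ)])
    (fun t => by rw [hzper, hUper])
    (fun t => by rw [hzper, hDper])
  have hexp : ∀ t : ℝ, exp (c * t) ^ 2 = exp (2 * c * t) := fun t => by
    rw [← Real.exp_nat_mul]
    congr 1
    push_cast
    ring
  have hexp2 : ∀ t : ℝ, exp t ^ 2 = exp (2 * t) := fun t => by
    rw [← Real.exp_nat_mul]
    norm_num
  have e1 : ∀ t θ, ‖U (z t θ)‖^2 = exp (2 * c * t) * ‖η (Complex.exp (z t θ))‖^2 := fun t θ => by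
    rw [hUdef, logPullback, norm_mul, mul_pow, hre, Complex.norm_real, Real.norm_eq_abs, sq_abs,
      hexp]
  have e2 : ∀ t θ, ‖fderiv ℝ U (z t θ) 1 - Complex.I * fderiv ℝ U (z t θ) Complex.I
      - c * U (z t θ)‖^2 = exp (2 * c * t) *
        (4 * exp (2 * t) * ‖wirtingerZ η (Complex.exp (z t θ))‖^2) := fun t θ => by
    have h : fderiv ℝ U (z t θ) 1 - Complex.I * fderiv ℝ U (z t θ) Complex.I - c * U (z t θ)
        = (exp (c * t) : ℝ) *
          (2 * Complex.exp (z t θ) * wirtingerZ η (Complex.exp (z t θ))) := by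
      rw [← fderiv_apply_self_sub, hUdef, fderiv_logPullback_apply (hη.differentiable two_ne_zero),
        fderiv_logPullback_apply (hη.differentiable two_ne_zero), logPullback, hre]
      simp
      ring
    rw [h]
    simp only [norm_mul, mul_pow, hnz, Complex.norm_real, Real.norm_eq_abs, sq_abs, hexp, hexp2]
    norm_num
  simpa only [e1, e2] using key

lemma exists_annulus_of_zero_notMem_tsupport {η : ℂ → ℂ} (hc : HasCompactSupport η)
    (h0 : (0 : ℂ) ∉ tsupport η) :
    ∃ s T : ℝ, s ≤ T ∧ ∀ x, (‖x‖ ≤ exp s ∨ exp T ≤ ‖x‖) → x ∉ tsupport η := by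
  obtain ⟨δ, hδ, hball⟩ := Metric.isOpen_iff.1 (isClosed_tsupport η).isOpen_compl 0 h0
  obtain ⟨R, hR⟩ := hc.isCompact.isBounded.subset_closedBall 0
  have hRp : 0 < max R δ + 1 := by linarith [le_max_right R δ]
  refine ⟨log (δ / 2), log (max R δ + 1), log_le_log (by linarith) ?_, fun x hx => ?_⟩
  · linarith [le_max_right R δ]
  · rw [exp_log (half_pos hδ), exp_log hRp] at hx
    rcases hx with hx | hx
    · exact hball (mem_ball_zero_iff.2 (by linarith))
    · intro hxs
      have := mem_closedBall_zero_iff.1 (hR hxs)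
      linarith [le_max_left R δ]

theorem weighted_wirtinger_hardy {a : ℝ} (ha : a ∈ Set.Icc (0 : ℝ) (1/2)) {η : ℂ → ℂ}
    (hs : ContDiff ℝ 2 η) (hc : HasCompactSupport η) (h0 : (0 : ℂ) ∉ tsupport η) :
    (1/2 - a)^2 * ∫ x : ℂ, ‖η x‖^2 * ‖x‖ ^ (2*a - 1) ≤
      ∫ x : ℂ, 4 * ‖x‖ * ‖wirtingerZ η x‖^2 * ‖x‖ ^ (2*a) := by
  obtain ⟨s, T, hsT, hout⟩ := exists_annulus_of_zero_notMem_tsupport hc h0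
  have hη0 : ∀ x, x ∉ tsupport η → η x = 0 := fun x => image_eq_zero_of_notMem_tsupport
  have hw0 : ∀ x, x ∉ tsupport η → wirtingerZ η x = 0 := fun x hx => by
    simp [wirtingerZ, fderiv_of_notMem_tsupport (𝕜 := ℝ) hx]
  have hnhds : ∀ᶠ x in nhds (0 : ℂ), x ∉ tsupport η :=
    (isClosed_tsupport η).isOpen_compl.eventually_mem h0
  have hW := continuous_wirtingerZ (hs.of_le one_le_two)
  have hηc := hs.continuous
  rw [integral_eq_exp_cylinder (s := s) (T := T)
      (continuous_mul_norm_rpow (by fun_prop) (hnhds.mono fun x hx => by simp [hη0 x hx]) _) hsT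
      (fun x hx => by simp [hη0 x (hout x (Or.inl hx))])
      (fun x hx => by simp [hη0 x (hout x (Or.inr hx.le))]),
    integral_eq_exp_cylinder (s := s) (T := T)
      (continuous_mul_norm_rpow (by fun_prop) (hnhds.mono fun x hx => by simp [hw0 x hx]) _) hsT
      (fun x hx => by simp [hw0 x (hout x (Or.inl hx))])
      (fun x hx => by simp [hw0 x (hout x (Or.inr hx.le))])]
  have key := logPullback_spectral_gap (c := a + 1/2) ⟨by linarith [ha.1], by linarith [ha.2]⟩ hsT
    hs (fun x hx => hη0 x (hout x (Or.inl hx.le))) (fun x hx => hη0 x (hout x (Or.inr hx.ge)))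
  have hn : ∀ t θ : ℝ, ‖Complex.exp (t + θ * Complex.I)‖ = exp t := fun t θ => by
    simp [Complex.norm_exp]
  have e1 : ∀ t : ℝ, exp (2 * (a + 1/2) * t) = exp (2 * t) * exp t ^ (2 * a - 1) := fun t => by
    rw [← Real.exp_mul, ← Real.exp_add]
    ring_nf
  have e2 : ∀ t : ℝ, exp (2 * (a + 1/2) * t) = exp t * exp t ^ (2 * a) := fun t => by
    rw [← Real.exp_mul, ← Real.exp_add]
    ring_nf
  have k1 : ∀ t θ : ℝ, exp (2 * t) * (‖η (Complex.exp (t + θ * Complex.I))‖^2 *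
      ‖Complex.exp (t + θ * Complex.I)‖ ^ (2*a - 1)) =
      exp (2 * (a + 1/2) * t) * ‖η (Complex.exp (t + θ * Complex.I))‖^2 := fun t θ => by
    rw [hn, e1]
    ring
  have k2 : ∀ t θ : ℝ, exp (2 * t) * (4 * ‖Complex.exp (t + θ * Complex.I)‖ *
      ‖wirtingerZ η (Complex.exp (t + θ * Complex.I))‖^2 *
      ‖Complex.exp (t + θ * Complex.I)‖ ^ (2*a)) = exp (2 * (a + 1/2) * t) *
      (4 * exp (2 * t) * ‖wirtingerZ η (Complex.exp (t + θ * Complex.I))‖^2) := fun t θ => by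
    rw [hn, e2]
    ring
  simp only [k1, k2]
  rwa [show 1 - (a + 1/2) = 1/2 - a by ring] at key

theorem stmt18 (a ν : ℝ) (ha : a ∈ Set.Ioo (0 : ℝ) (1/2)) (hν : ν ∈ Set.Ioc (0 : ℝ) (1/2 - a))
    (η : ℂ → ℂ) (hs : ContDiff ℝ (⊤ : ℕ∞) η) (hc : HasCompactSupport η) (h0 : (0 : ℂ) ∉ tsupport η) :
    ∫ x : ℂ, ((4/ν) * ‖x‖ * ‖wirtingerZ η x‖^2 + 2 * ‖η x‖^2) * ‖x‖ ^ (2*a)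
      ≥ ν * ∫ x : ℂ, ‖η x‖^2 * ‖x‖ ^ (2*a - 1) := by
  obtain ⟨hν0, hν1⟩ := hν
  have hs2 : ContDiff ℝ 2 η := by exact_mod_cast contDiff_infty.1 hs 2
  have hW := continuous_wirtingerZ (hs2.of_le one_le_two)
  have hηc := hs2.continuous
  have hη0 : ∀ x, x ∉ tsupport η →
      (4/ν) * ‖x‖ * ‖wirtingerZ η x‖^2 + 2 * ‖η x‖^2 = 0 := fun x hx => by
    simp [wirtingerZ, fderiv_of_notMem_tsupport (𝕜 := ℝ) hx, image_eq_zero_of_notMem_tsupport hx]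
  have hcont : Continuous fun x : ℂ =>
      ((4/ν) * ‖x‖ * ‖wirtingerZ η x‖^2 + 2 * ‖η x‖^2) * ‖x‖ ^ (2*a) :=
    continuous_mul_norm_rpow (by fun_prop)
      (((isClosed_tsupport η).isOpen_compl.eventually_mem h0).mono hη0) _
  have hint := hcont.integrable_of_hasCompactSupport (μ := volume)
    (HasCompactSupport.intro hc.isCompact fun x hx => by rw [hη0 x hx, zero_mul])
  have hI : 0 ≤ ∫ x : ℂ, ‖η x‖^2 * ‖x‖ ^ (2*a - 1) := integral_nonneg fun x => by positivity
  have hsq : ν^2 ≤ (1/2 - a)^2 := by gcongr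
  calc ν * ∫ x : ℂ, ‖η x‖^2 * ‖x‖ ^ (2*a - 1)
      = ν⁻¹ * (ν^2 * ∫ x : ℂ, ‖η x‖^2 * ‖x‖ ^ (2*a - 1)) := by field_simp
    _ ≤ ν⁻¹ * ∫ x : ℂ, 4 * ‖x‖ * ‖wirtingerZ η x‖^2 * ‖x‖ ^ (2*a) := by
        refine mul_le_mul_of_nonneg_left ?_ (inv_nonneg.2 hν0.le)
        exact (mul_le_mul_of_nonneg_right hsq hI).trans
          (weighted_wirtinger_hardy ⟨ha.1.le, ha.2.le⟩ hs2 hc h0)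
    _ = ∫ x : ℂ, ν⁻¹ * (4 * ‖x‖ * ‖wirtingerZ η x‖^2 * ‖x‖ ^ (2*a)) := by
        rw [integral_const_mul]
    _ ≤ _ := by
        refine integral_mono_of_nonneg (Filter.Eventually.of_forall fun x => ?_) hint
          (Filter.Eventually.of_forall fun x => ?_)
        · simp only [Pi.zero_apply]
          positivity
        · have : 0 ≤ 2 * ‖η x‖^2 * ‖x‖ ^ (2*a) := by positivity
          simp only [add_mul, div_eq_mul_inv]
          linarith
end

section
/- Let ℓ ∈ ℤ with ℓ ≥ 0, a ∈ [0,1/2), ν > 0 with ν < c_ℓ(a) := 1/2 + ℓ − a. Set δ = √(c_ℓ(a)² − ν²), A = a − 1/2 + δ, B = ν/c_ℓ(a), λ = δ/c_ℓ(a), and φ(ρ) = ρ^A e^{−Bρ} for ρ > 0. Then for every ρ > 0, −(d/dρ)[ (ρ φ'(ρ) − ℓ φ(ρ)) / ((1+λ)ρ + ν) ] − (ℓ + 1 − 2a) · (φ'(ρ) − (ℓ/ρ) φ(ρ)) / ((1+λ)ρ + ν) + (1 − λ − ν/ρ) φ(ρ) = 0. -/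
open MeasureTheory

theorem hasDerivAt_rpow_mul_exp (A B : ℝ) {ρ : ℝ} (hρ : 0 < ρ) :
    HasDerivAt (fun r : ℝ => r ^ A * Real.exp (-B * r))
      ((A / ρ - B) * (ρ ^ A * Real.exp (-B * ρ))) ρ := by
  have h₁ := Real.hasDerivAt_rpow_const (p := A) (Or.inl hρ.ne')
  have h₂ := ((hasDerivAt_id ρ).const_mul (-B)).exp
  refine (h₁.mul h₂).congr_deriv ?_
  rw [Real.rpow_sub_one hρ.ne']
  simp only [id]
  ring

theorem stmt19 (ℓ : ℤ) (hℓ : 0 ≤ ℓ) (a ν : ℝ) (ha : a ∈ Set.Ico (0 : ℝ) (1/2))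
    (hν : 0 < ν) (hνc : ν < 1/2 + (ℓ : ℝ) - a)
    (cl δ A B lam : ℝ) (hcl : cl = 1/2 + (ℓ : ℝ) - a) (hδ : δ = Real.sqrt (cl^2 - ν^2))
    (hA : A = a - 1/2 + δ) (hB : B = ν / cl) (hlam : lam = δ / cl)
    (φ : ℝ → ℝ) (hφ : ∀ ρ > (0 : ℝ), φ ρ = ρ ^ A * Real.exp (-B * ρ)) :
    ∀ ρ > (0 : ℝ),
      -(deriv (fun r : ℝ => (r * deriv φ r - (ℓ : ℝ) * φ r) / ((1 + lam) * r + ν)) ρ)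
        - ((ℓ : ℝ) + 1 - 2*a) * ((deriv φ ρ - ((ℓ : ℝ)/ρ) * φ ρ) / ((1 + lam) * ρ + ν))
        + (1 - lam - ν/ρ) * φ ρ = 0 := by
  have hν_lt : ν < cl := hcl ▸ hνc
  have hcl_pos : 0 < cl := hν.trans hν_lt
  have hδ_nonneg : 0 ≤ δ := hδ ▸ Real.sqrt_nonneg _
  have hδ_sq : δ ^ 2 = cl ^ 2 - ν ^ 2 := by
    rw [hδ, Real.sq_sqrt]
    nlinarith
  have hsum : 0 < cl + δ := by positivity
  have hlam_nonneg : 0 ≤ lam := hlam ▸ by positivity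
  have hφ' : ∀ r > (0 : ℝ), HasDerivAt φ ((A / r - B) * φ r) r := by
    intro r hr
    rw [hφ r hr]
    refine (hasDerivAt_rpow_mul_exp A B hr).congr_of_eventuallyEq ?_
    filter_upwards [lt_mem_nhds hr] with x hx using hφ x hx
  have hden : ∀ r > (0 : ℝ), (1 + lam) * r + ν ≠ 0 := fun r hr => by positivity
  -- The lower component is a constant multiple of `φ`.
  have hlower : ∀ r > (0 : ℝ), (r * deriv φ r - (ℓ : ℝ) * φ r) / ((1 + lam) * r + ν)
      = -(ν / (cl + δ)) * φ r := by
    intro r hr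
    have hnum : A - ℓ - B * r = -(ν / (cl + δ)) * ((1 + lam) * r + ν) := by
      have hAℓ : A - ℓ = δ - cl := by rw [hA, hcl]; ring
      rw [hAℓ, hB, hlam]
      field_simp
      linear_combination cl * hδ_sq
    rw [(hφ' r hr).deriv, div_eq_iff (hden r hr)]
    have hr0 : r * (A / r) = A := mul_div_cancel₀ A hr.ne'
    linear_combination φ r * hr0 + φ r * hnum
  intro ρ hρ
  have hderiv : deriv (fun r : ℝ => (r * deriv φ r - (ℓ : ℝ) * φ r) / ((1 + lam) * r + ν)) ρ
      = -(ν / (cl + δ)) * ((A / ρ - B) * φ ρ) := by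
    refine (((hφ' ρ hρ).const_mul (-(ν / (cl + δ)))).congr_of_eventuallyEq ?_).deriv
    filter_upwards [lt_mem_nhds hρ] with x hx using hlower x hx
  have hsecond : (deriv φ ρ - ((ℓ : ℝ) / ρ) * φ ρ) / ((1 + lam) * ρ + ν)
      = -(ν / (cl + δ)) * φ ρ / ρ := by
    rw [← hlower ρ hρ]
    have := hden ρ hρ
    field_simp
  have hcoeff : ν / (cl + δ) * (A / ρ - B) + (ℓ + 1 - 2 * a) * (ν / (cl + δ)) / ρ
      + (1 - lam - ν / ρ) = 0 := by
    have hℓ' : (ℓ : ℝ) + 1 - 2 * a = cl + δ - A := by rw [hA, hcl]; ring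
    rw [hℓ', hB, hlam]
    field_simp
    linear_combination -ρ * hδ_sq
  rw [hderiv, hsecond]
  linear_combination φ ρ * hcoeff
end
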